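/- arXiv:1611.01955 — 3 statements merged into one kernel-verified Lean document; each statement's English description precedes it below -/
import Mathlib

section
/- For every τ in the complex upper half-plane ℍ and every z ∈ ℂ with z ∉ Λ_τ, the Weierstrass ℘-function satisfies ℘′(z;τ)² = 4(℘(z;τ) − e₁(τ))(℘(z;τ) − e₂(τ))(℘(z;τ) − e₃(τ)); in particular e₁(τ), e₂(τ), e₃(τ) are the roots of the cubic 4X³ − g₂(τ)X − g₃(τ). -/
noncomputable section

/-- `z` belongs to the lattice `Λ_τ = ℤ + τℤ`. -/
def IsLatticePt (τ z : ℂ) : Prop := ∃ m n : ℤ, z = (m : ℂ) + (n : ℂ) * τ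

/-- The Weierstrass `℘`-function of the lattice `Λ_τ = ℤ + τℤ`:
`℘(z;τ) = 1/z² + Σ_{ω ∈ Λ_τ∖{0}} (1/(z−ω)² − 1/ω²)`. -/
def wp (τ z : ℂ) : ℂ :=
  1 / z ^ 2 + ∑' p : ℤ × ℤ, if p = 0 then 0 else
    (1 / (z - ((p.1 : ℂ) + (p.2 : ℂ) * τ)) ^ 2 - 1 / ((p.1 : ℂ) + (p.2 : ℂ) * τ) ^ 2)

/-- The derivative `℘′(z;τ)` of the Weierstrass `℘`-function with respect to `z`. -/
def wp' (τ z : ℂ) : ℂ := deriv (wp τ) z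

/-- The invariant `g₂(τ) = 60 Σ_{ω ∈ Λ_τ∖{0}} ω⁻⁴`. -/
def g2 (τ : ℂ) : ℂ :=
  60 * ∑' p : ℤ × ℤ, if p = 0 then 0 else (((p.1 : ℂ) + (p.2 : ℂ) * τ) ^ 4)⁻¹

/-- The invariant `g₃(τ) = 140 Σ_{ω ∈ Λ_τ∖{0}} ω⁻⁶`. -/
def g3 (τ : ℂ) : ℂ :=
  140 * ∑' p : ℤ × ℤ, if p = 0 then 0 else (((p.1 : ℂ) + (p.2 : ℂ) * τ) ^ 6)⁻¹

/-- The half-period value `e₁(τ) = ℘(1/2;τ)`. -/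
def e1 (τ : ℂ) : ℂ := wp τ (1 / 2)

/-- The half-period value `e₂(τ) = ℘((1+τ)/2;τ)`. -/
def e2 (τ : ℂ) : ℂ := wp τ ((1 + τ) / 2)

/-- The half-period value `e₃(τ) = ℘(τ/2;τ)`. -/
def e3 (τ : ℂ) : ℂ := wp τ (τ / 2)

/-- The modular lambda function `λ(τ) = (e₂(τ) − e₁(τ))/(e₃(τ) − e₁(τ))`. -/
def mlambda (τ : ℂ) : ℂ := (e2 τ - e1 τ) / (e3 τ - e1 τ)

end

section helpers
open Filter Topology

lemma aux_order (g q : ℂ → ℂ) (x : ℂ) (hg : AnalyticAt ℂ g x) (hq : AnalyticAt ℂ q x)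
    (h0 : g x = 0) (h1 : deriv g x = 0)
    (h2 : deriv (deriv g) =ᶠ[𝓝 x] q * g) : ∀ᶠ z in 𝓝 x, g z = 0 := by
  rw [← analyticOrderAt_eq_top]
  have a1 := hg.analyticOrderAt_deriv_add_one
  have a2 := hg.deriv.analyticOrderAt_deriv_add_one
  rw [analyticOrderAt_congr h2, analyticOrderAt_mul hq hg] at a2
  simp only [h0, h1, sub_zero] at a1 a2
  change _ = analyticOrderAt (deriv g) x at a2
  change _ = analyticOrderAt g x at a1
  rw [← a2] at a1
  by_contra hne
  generalize analyticOrderAt g x = n at *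
  generalize analyticOrderAt q x = m at *
  lift n to ℕ using hne
  induction m with
  | top => simp at a1
  | coe m => norm_cast at a1; omega

variable (L : PeriodPair)

lemma countable_lat : (L.lattice : Set ℂ).Countable :=
  Set.countable_coe_iff.mp (L.latticeEquivProd.toEquiv.injective.countable)

lemma not_analytic_zero (f : ℂ → ℂ) (hf : AnalyticAt ℂ f 0) :
    ¬ (L.weierstrassP =ᶠ[𝓝[≠] 0] f) := by
  intro h
  have := hf.meromorphicOrderAt_nonneg
  rw [← meromorphicOrderAt_congr h, L.order_weierstrassP 0 (zero_mem _)] at this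
  exact absurd this (by decide)

lemma eventually_notMem : ∀ᶠ z in 𝓝[≠] (0:ℂ), z ∉ L.lattice := by
  have := L.compl_lattice_sdiff_singleton_mem_nhds 0
  filter_upwards [nhdsWithin_le_nhds this, self_mem_nhdsWithin] with z hz hz0 hl
  exact hz ⟨hl, hz0⟩

lemma deriv_not_zero (x : ℂ) (hx : x ∉ L.lattice) :
    ¬ ∀ᶠ z in 𝓝 x, L.derivWeierstrassP z = 0 := by
  intro h
  have hc : IsPreconnected ((L.lattice : Set ℂ)ᶜ) :=
    ((countable_lat L).isConnected_compl_of_one_lt_rank (by simp)).isPreconnected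
  have := L.analyticOnNhd_derivWeierstrassP.eqOn_of_preconnected_of_eventuallyEq
    (g := fun _ => 0) (fun _ _ => analyticAt_const) hc (z₀ := x) hx h
  have hcst : ∀ y ∉ L.lattice, L.weierstrassP y = L.weierstrassP x := fun y hy =>
    L.isClosed_lattice.isOpen_compl.is_const_of_deriv_eq_zero hc L.differentiableOn_weierstrassP
      (fun z hz => by rw [L.deriv_weierstrassP]; exact this hz) hy hx
  apply not_analytic_zero L (fun _ => L.weierstrassP x) analyticAt_const
  filter_upwards [eventually_notMem L] with z hz using hcst z hz

lemma nhds_notMem (x : ℂ) (hx : x ∉ L.lattice) : ∀ᶠ z in 𝓝 x, z ∉ L.lattice :=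
  L.isClosed_lattice.isOpen_compl.mem_nhds hx

lemma second_deriv (x : ℂ) (hx : x ∉ L.lattice) :
    deriv L.derivWeierstrassP =ᶠ[𝓝 x] fun z => 6 * L.weierstrassP z ^ 2 - L.g₂ / 2 := by
  have hP : AnalyticAt ℂ L.weierstrassP x := L.analyticOnNhd_weierstrassP x hx
  have hD : AnalyticAt ℂ L.derivWeierstrassP x := L.analyticOnNhd_derivWeierstrassP x hx
  have hR : AnalyticAt ℂ (fun z => 2 * deriv L.derivWeierstrassP z
      - (12 * L.weierstrassP z ^ 2 - L.g₂)) x := by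
    have := hD.deriv
    fun_prop
  have key : ∀ᶠ z in 𝓝 x, ((L.derivWeierstrassP * (fun z => 2 * deriv L.derivWeierstrassP z
      - (12 * L.weierstrassP z ^ 2 - L.g₂)) : ℂ → ℂ)) z = 0 := by
    filter_upwards [nhds_notMem L x hx] with y hy
    have hP' : HasDerivAt L.weierstrassP (L.derivWeierstrassP y) y := by
      rw [← L.deriv_weierstrassP]
      exact (L.analyticOnNhd_weierstrassP y hy).differentiableAt.hasDerivAt
    have hD' : HasDerivAt L.derivWeierstrassP (deriv L.derivWeierstrassP y) y :=
      (L.analyticOnNhd_derivWeierstrassP y hy).differentiableAt.hasDerivAt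
    have e1 := hD'.pow 2
    have e2 := (((hP'.pow 3).const_mul 4).sub (hP'.const_mul L.g₂)).sub_const L.g₃
    have e3 := e1.unique (e2.congr_of_eventuallyEq (by
      filter_upwards [nhds_notMem L y hy] with z hz
      simpa using L.derivWeierstrassP_sq z hz))
    simp at e3
    simp only [Pi.mul_apply]
    linear_combination e3
  rw [← analyticOrderAt_eq_top, analyticOrderAt_mul hD hR, ENat.add_eq_top,
    analyticOrderAt_eq_top, analyticOrderAt_eq_top] at key
  filter_upwards [key.resolve_left (deriv_not_zero L x hx)] with z hz
  linear_combination hz / 2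

lemma half_deriv (h : ℂ) (h2 : 2 * h ∈ L.lattice) : L.derivWeierstrassP h = 0 := by
  have := L.derivWeierstrassP_sub_coe h ⟨2 * h, h2⟩
  rw [show h - ((⟨2 * h, h2⟩ : L.lattice) : ℂ) = -h by simp; ring, L.derivWeierstrassP_neg] at this
  linear_combination -this / 2

lemma half_ne (h k : ℂ) (hh : h ∉ L.lattice) (hk : k ∉ L.lattice) (h2 : 2 * h ∈ L.lattice)
    (k2 : 2 * k ∈ L.lattice) (hd : k - h ∉ L.lattice) : L.weierstrassP h ≠ L.weierstrassP k := by
  intro he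
  set d := k - h with hd_def
  have hkd : h + d = k := by simp [d]
  have shA (z : ℂ) (hz : z + d ∉ L.lattice) : AnalyticAt ℂ (fun z => L.weierstrassP (z + d)) z :=
    AnalyticAt.fun_comp (L.analyticOnNhd_weierstrassP _ hz) (by fun_prop)
  have ht : Tendsto (fun z => z + d) (𝓝 h) (𝓝 k) := by
    have : ContinuousAt (fun z : ℂ => z + d) h := by fun_prop
    rw [ContinuousAt, hkd] at this; exact this
  have hPh := L.analyticOnNhd_weierstrassP h hh
  have hPk := shA h (hkd ▸ hk)
  have hder : ∀ z, z ∉ L.lattice → z + d ∉ L.lattice →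
      deriv (fun z => L.weierstrassP z - L.weierstrassP (z + d)) z =
      L.derivWeierstrassP z - L.derivWeierstrassP (z + d) := by
    intro z hz hzd
    rw [deriv_fun_sub (L.analyticOnNhd_weierstrassP z hz).differentiableAt
      (shA z hzd).differentiableAt, deriv_comp_add_const, L.deriv_weierstrassP]
  have hev : ∀ᶠ z in 𝓝 h, z ∉ L.lattice ∧ z + d ∉ L.lattice :=
    (nhds_notMem L h hh).and (ht.eventually (nhds_notMem L k hk))
  have hz := aux_order (fun z => L.weierstrassP z - L.weierstrassP (z + d))
    (fun z => 6 * (L.weierstrassP z + L.weierstrassP (z + d))) h (hPh.sub hPk)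
    (analyticAt_const.mul (hPh.add hPk)) (by simp [hkd, he])
    (by rw [hder h hh (hkd ▸ hk), hkd, half_deriv L h h2, half_deriv L k k2, sub_zero])
    (by
      have e1 : deriv (fun z => L.weierstrassP z - L.weierstrassP (z + d)) =ᶠ[𝓝 h]
          fun z => L.derivWeierstrassP z - L.derivWeierstrassP (z + d) := by
        filter_upwards [hev] with z hz using hder z hz.1 hz.2
      filter_upwards [e1.deriv, hev, second_deriv L h hh, ht.eventually (second_deriv L k hk)]
        with z a1 a2 a3 a4
      rw [a1, deriv_fun_sub (L.analyticOnNhd_derivWeierstrassP z a2.1).differentiableAt,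
        deriv_comp_add_const, a3, a4]
      · simp only [Pi.mul_apply]; ring
      · have := (L.analyticOnNhd_derivWeierstrassP (z + d) a2.2).differentiableAt
        exact DifferentiableAt.fun_comp' (f := fun z => z + d) z this (by fun_prop))
  have hcU : ((L.lattice : Set ℂ) ∪ (fun z => z + d) ⁻¹' L.lattice).Countable :=
    (countable_lat L).union ((countable_lat L).preimage (add_left_injective d))
  have hc := (hcU.isConnected_compl_of_one_lt_rank (by simp)).isPreconnected
  have hU : ∀ z, z ∈ ((L.lattice : Set ℂ) ∪ (fun z => z + d) ⁻¹' L.lattice)ᶜ ↔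
      z ∉ L.lattice ∧ z + d ∉ L.lattice := by intro z; simp
  have heq := AnalyticOnNhd.eqOn_of_preconnected_of_eventuallyEq (f := L.weierstrassP)
    (g := fun z => L.weierstrassP (z + d))
    (fun z hz => L.analyticOnNhd_weierstrassP z ((hU z).1 hz).1)
    (fun z hz => shA z ((hU z).1 hz).2) hc (z₀ := h) ((hU h).2 ⟨hh, hkd ▸ hk⟩)
    (by filter_upwards [hz] with z hz using sub_eq_zero.1 hz)
  apply not_analytic_zero L _ (shA 0 (by simpa using hd))
  have ht0 : Tendsto (fun z => z + d) (𝓝 0) (𝓝 d) := by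
    have : ContinuousAt (fun z : ℂ => z + d) 0 := by fun_prop
    rw [ContinuousAt, zero_add] at this; exact this
  filter_upwards [eventually_notMem L,
    nhdsWithin_le_nhds (ht0.eventually (nhds_notMem L d hd))] with z hz1 hz2
  exact heq ((hU z).2 ⟨hz1, hz2⟩)

/-- period pair `(1, τ)` -/
noncomputable def tauPair (τ : ℂ) (hτ : 0 < τ.im) : PeriodPair where
  ω₁ := 1
  ω₂ := τ
  indep := by
    rw [LinearIndependent.pair_iff]
    intro s t h
    have him := congrArg Complex.im h
    have hre := congrArg Complex.re h
    simp at him hre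
    have ht : t = 0 := by
      rcases him with h | h
      · exact h
      · exact absurd h hτ.ne'
    subst ht
    simpa using hre

lemma tau_sum (τ : ℂ) (hτ : 0 < τ.im) (f : ℂ → ℂ) :
    ∑' p : ℤ × ℤ, (if p = 0 then 0 else f ((p.1 : ℂ) + (p.2 : ℂ) * τ)) =
      ∑' l : (tauPair τ hτ).lattice, if (l : ℂ) = 0 then 0 else f l := by
  rw [← (tauPair τ hτ).latticeEquivProd.symm.toEquiv.tsum_eq]
  congr 1
  ext p
  have h := (tauPair τ hτ).latticeEquiv_symm_apply p
  have h' : (((tauPair τ hτ).latticeEquivProd.symm p : (tauPair τ hτ).lattice) : ℂ) = 0 ↔ p = 0 := by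
    simp
  simp only [LinearEquiv.coe_toEquiv, h']
  rw [h]
  simp [tauPair]

lemma wp_eq (τ : ℂ) (hτ : 0 < τ.im) : wp τ = (tauPair τ hτ).weierstrassP := by
  ext z
  rw [← (tauPair τ hτ).weierstrassPExcept_add 0, wp, PeriodPair.weierstrassPExcept,
    tau_sum τ hτ (fun w => 1 / (z - w) ^ 2 - 1 / w ^ 2)]
  simp [add_comm]

lemma g2_eq (τ : ℂ) (hτ : 0 < τ.im) : g2 τ = (tauPair τ hτ).g₂ := by
  rw [g2, PeriodPair.g₂, PeriodPair.G, tau_sum τ hτ (fun w => (w ^ 4)⁻¹)]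
  congr 2
  ext l
  split_ifs with h <;> simp [h]

lemma g3_eq (τ : ℂ) (hτ : 0 < τ.im) : g3 τ = (tauPair τ hτ).g₃ := by
  rw [g3, PeriodPair.g₃, PeriodPair.G, tau_sum τ hτ (fun w => (w ^ 6)⁻¹)]
  congr 2
  ext l
  split_ifs with h <;> simp [h]

lemma mem_iff (τ : ℂ) (hτ : 0 < τ.im) (z : ℂ) : z ∈ (tauPair τ hτ).lattice ↔ IsLatticePt τ z := by
  rw [PeriodPair.mem_lattice, IsLatticePt]
  simp [tauPair, eq_comm]

lemma half_notMem (τ : ℂ) (hτ : 0 < τ.im) (a b : ℤ) (h : ¬ (2 ∣ a ∧ 2 ∣ b)) :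
    (a + b * τ) / 2 ∉ (tauPair τ hτ).lattice := by
  rw [mem_iff]
  rintro ⟨m, n, e⟩
  have e' : (a : ℂ) + b * τ = 2 * m + 2 * n * τ := by linear_combination 2 * e
  have him := congrArg Complex.im e'
  simp at him
  have hb : b = 2 * n := by
    rcases him with h | h
    · have h3 : (b : ℝ) = ((2 * n : ℤ) : ℝ) := by push_cast; exact h
      exact_mod_cast h3
    · exact absurd h hτ.ne'
  subst hb
  have ha : (a : ℂ) = ((2 * m : ℤ) : ℂ) := by push_cast at e' ⊢; linear_combination e'
  have ha' : a = 2 * m := by exact_mod_cast ha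
  exact h ⟨⟨m, ha'⟩, ⟨n, rfl⟩⟩

end helpers

/-- For every `τ` in the upper half-plane and every `z ∉ Λ_τ`, the
Weierstrass `℘`-function satisfies
`℘′(z;τ)² = 4(℘(z;τ) − e₁(τ))(℘(z;τ) − e₂(τ))(℘(z;τ) − e₃(τ))`;
in particular `e₁(τ), e₂(τ), e₃(τ)` are the roots of the cubic `4X³ − g₂(τ)X − g₃(τ)`. -/
theorem wp_deriv_sq_eq (τ : ℂ) (hτ : 0 < τ.im) :
    (∀ z : ℂ, ¬IsLatticePt τ z →
      wp' τ z ^ 2 = 4 * (wp τ z - e1 τ) * (wp τ z - e2 τ) * (wp τ z - e3 τ)) ∧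
    (4 * e1 τ ^ 3 - g2 τ * e1 τ - g3 τ = 0) ∧
    (4 * e2 τ ^ 3 - g2 τ * e2 τ - g3 τ = 0) ∧
    (4 * e3 τ ^ 3 - g2 τ * e3 τ - g3 τ = 0) := by
  set L := tauPair τ hτ with hL
  have n1 : (1 / 2 : ℂ) ∉ L.lattice := by simpa using half_notMem τ hτ 1 0 (by decide)
  have n2 : ((1 + τ) / 2 : ℂ) ∉ L.lattice := by simpa using half_notMem τ hτ 1 1 (by decide)
  have n3 : (τ / 2 : ℂ) ∉ L.lattice := by simpa using half_notMem τ hτ 0 1 (by decide)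
  have p1 : (2 * (1 / 2) : ℂ) ∈ L.lattice := (mem_iff τ hτ _).2 ⟨1, 0, by simp⟩
  have p2 : (2 * ((1 + τ) / 2) : ℂ) ∈ L.lattice :=
    (mem_iff τ hτ _).2 ⟨1, 1, by push_cast; ring⟩
  have p3 : (2 * (τ / 2) : ℂ) ∈ L.lattice := (mem_iff τ hτ _).2 ⟨0, 1, by push_cast; ring⟩
  have d12 : ((1 + τ) / 2 - 1 / 2 : ℂ) ∉ L.lattice := by
    rwa [show ((1 + τ) / 2 - 1 / 2 : ℂ) = τ / 2 by ring]
  have d32 : ((1 + τ) / 2 - τ / 2 : ℂ) ∉ L.lattice := by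
    rwa [show ((1 + τ) / 2 - τ / 2 : ℂ) = 1 / 2 by ring]
  have d13 : (τ / 2 - 1 / 2 : ℂ) ∉ L.lattice := by
    have := half_notMem τ hτ (-1) 1 (by decide)
    rwa [show (((-1 : ℤ) : ℂ) + ((1 : ℤ) : ℂ) * τ) / 2 = τ / 2 - 1 / 2 by push_cast; ring] at this
  have ne12 : e1 τ ≠ e2 τ := by
    rw [e1, e2, wp_eq τ hτ]; exact half_ne L _ _ n1 n2 p1 p2 d12
  have ne13 : e1 τ ≠ e3 τ := by
    rw [e1, e3, wp_eq τ hτ]; exact half_ne L _ _ n1 n3 p1 p3 d13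
  have ne32 : e3 τ ≠ e2 τ := by
    rw [e3, e2, wp_eq τ hτ]; exact half_ne L _ _ n3 n2 p3 p2 d32
  have root : ∀ h, h ∉ L.lattice → 2 * h ∈ L.lattice →
      4 * wp τ h ^ 3 - g2 τ * wp τ h - g3 τ = 0 := by
    intro h hh h2
    have := L.derivWeierstrassP_sq h hh
    rw [half_deriv L h h2] at this
    rw [wp_eq τ hτ, g2_eq τ hτ, g3_eq τ hτ, ← hL]
    linear_combination -this
  have r1 : 4 * e1 τ ^ 3 - g2 τ * e1 τ - g3 τ = 0 := root _ n1 p1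
  have r2 : 4 * e2 τ ^ 3 - g2 τ * e2 τ - g3 τ = 0 := root _ n2 p2
  have r3 : 4 * e3 τ ^ 3 - g2 τ * e3 τ - g3 τ = 0 := root _ n3 p3
  refine ⟨fun z hz => ?_, r1, r2, r3⟩
  have hz' : z ∉ L.lattice := fun h => hz ((mem_iff τ hτ z).1 h)
  have hsq := L.derivWeierstrassP_sq z hz'
  have hw : wp' τ z ^ 2 = 4 * wp τ z ^ 3 - g2 τ * wp τ z - g3 τ := by
    rw [wp', wp_eq τ hτ, g2_eq τ hτ, g3_eq τ hτ, ← hL, L.deriv_weierstrassP, hsq]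
  rw [hw]
  generalize wp τ z = X
  generalize e1 τ = a at *
  generalize e2 τ = b at *
  generalize e3 τ = c at *
  generalize g2 τ = p at *
  generalize g3 τ = q at *
  have f1 : 4 * (a ^ 2 + a * b + b ^ 2) = p := by
    apply mul_left_cancel₀ (sub_ne_zero.2 ne12); linear_combination r1 - r2
  have f2 : 4 * (a ^ 2 + a * c + c ^ 2) = p := by
    apply mul_left_cancel₀ (sub_ne_zero.2 ne13); linear_combination r1 - r3
  have f3 : a + b + c = 0 := by
    apply mul_left_cancel₀ (sub_ne_zero.2 ne32); linear_combination (f2 - f1) / 4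
  have hc : c = -a - b := by linear_combination f3
  subst hc
  subst f1
  linear_combination r1
end

section
/- The modular lambda function λ : ℍ → ℂ∖{0,1} is surjective: for every complex number μ with μ ≠ 0 and μ ≠ 1, there exists τ in the complex upper half-plane ℍ with λ(τ) = μ. -/
namespace MLam
open PeriodPair Filter Topology

theorem countable_lattice (L : PeriodPair) : (L.lattice : Set ℂ).Countable := by
  have : Countable L.lattice := L.latticeEquivProd.toEquiv.countable_iff.mpr inferInstance
  exact Set.countable_coe_iff.mp this

theorem preconn (L : PeriodPair) : IsPreconnected (L.lattice : Set ℂ)ᶜ := by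
  refine ((countable_lattice L).isConnected_compl_of_one_lt_rank ?_).isPreconnected
  rw [Complex.rank_real_complex]; norm_num

theorem punct (L : PeriodPair) : ∀ᶠ z in 𝓝[≠] (0:ℂ), z ∈ (L.lattice : Set ℂ)ᶜ := by
  have := L.compl_lattice_sdiff_singleton_mem_nhds 0
  rw [eventually_nhdsWithin_iff]
  filter_upwards [this] with z hz h0 h
  exact hz ⟨h, h0⟩

theorem not_analytic (L : PeriodPair) (g : ℂ → ℂ) (hg : AnalyticAt ℂ g 0)
    (h : ℘[L] =ᶠ[𝓝[≠] 0] g) : False := by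
  have h1 := L.order_weierstrassP 0 (zero_mem _)
  rw [meromorphicOrderAt_congr h] at h1
  have h2 := hg.meromorphicOrderAt_nonneg
  rw [h1] at h2
  exact absurd h2 (by decide)

theorem second_ode (L : PeriodPair) (z : ℂ) (hz : z ∉ L.lattice) :
    deriv ℘'[L] z = 6 * ℘[L] z ^ 2 - L.g₂ / 2 := by
  have hU : IsOpen (L.lattice : Set ℂ)ᶜ := L.isClosed_lattice.isOpen_compl
  have A1 := L.analyticOnNhd_derivWeierstrassP
  have A0 := L.analyticOnNhd_weierstrassP
  have A2 : AnalyticOnNhd ℂ (fun z => deriv ℘'[L] z - (6 * ℘[L] z ^ 2 - L.g₂ / 2))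
      (L.lattice : Set ℂ)ᶜ := fun x hx => by
    have h1 := A0 x hx
    have h2 := (A1 x hx).deriv
    fun_prop
  rcases AnalyticOnNhd.eq_zero_or_eq_zero_of_smul_eq_zero A1 A2 (by
    intro x hx
    have d0 : HasDerivAt ℘[L] (℘'[L] x) x := by
      rw [← L.deriv_weierstrassP]; exact (A0 x hx).differentiableAt.hasDerivAt
    have d1 := (A1 x hx).differentiableAt.hasDerivAt
    have e : (fun z => ℘'[L] z ^ 2) =ᶠ[𝓝 x] fun z => 4 * ℘[L] z ^ 3 - L.g₂ * ℘[L] z - L.g₃ := by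
      filter_upwards [hU.mem_nhds hx] with y hy using L.derivWeierstrassP_sq y hy
    have := ((d1.pow 2).congr_of_eventuallyEq (e.symm)).unique
      ((((d0.pow 3).const_mul 4).sub (d0.const_mul L.g₂)).sub_const L.g₃)
    simp only [smul_eq_mul, Pi.zero_apply]
    push_cast at this
    linear_combination this / 2) (preconn L) with h | h
  · exfalso
    obtain ⟨a, ha⟩ := hU.exists_is_const_of_deriv_eq_zero (preconn L) A0.differentiableOn
      (by rw [L.deriv_weierstrassP]; exact h)
    refine not_analytic L (fun _ => a) analyticAt_const ?_
    filter_upwards [punct L] with y hy using ha y hy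
  · have := h z hz
    simpa [sub_eq_zero] using this

theorem inj (L : PeriodPair) (a c : ℂ) (ha : a ∉ L.lattice) (hb : a + c ∉ L.lattice)
    (hc : c ∉ L.lattice) (h0 : ℘[L] a = ℘[L] (a + c)) (h1 : ℘'[L] a = ℘'[L] (a + c)) : False := by
  have hU : IsOpen (L.lattice : Set ℂ)ᶜ := L.isClosed_lattice.isOpen_compl
  have A1 := L.analyticOnNhd_derivWeierstrassP
  have A0 := L.analyticOnNhd_weierstrassP
  set V : Set ℂ := (L.lattice : Set ℂ) ∪ (fun z => z + c) ⁻¹' (L.lattice : Set ℂ) with hV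
  have hVc : V.Countable := (countable_lattice L).union
    ((countable_lattice L).preimage (add_left_injective c))
  have hVp : IsPreconnected Vᶜ := by
    refine (hVc.isConnected_compl_of_one_lt_rank ?_).isPreconnected
    rw [Complex.rank_real_complex]; norm_num
  have S0 : ∀ x, x + c ∉ L.lattice → AnalyticAt ℂ (fun z => ℘[L] (z + c)) x := fun x hx =>
    AnalyticAt.fun_comp (g := ℘[L]) (f := fun z => z + c) (A0 _ hx) (by fun_prop)
  have S1 : ∀ x, x + c ∉ L.lattice → AnalyticAt ℂ (fun z => ℘'[L] (z + c)) x := fun x hx =>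
    AnalyticAt.fun_comp (g := ℘'[L]) (f := fun z => z + c) (A1 _ hx) (by fun_prop)
  have na : ∀ᶠ z in 𝓝 a, z ∉ L.lattice := hU.mem_nhds ha
  have nb : ∀ᶠ z in 𝓝 a, z + c ∉ L.lattice :=
    (continuous_add_const c).continuousAt.preimage_mem_nhds (hU.mem_nhds hb)
  set w : ℂ → ℂ := fun z => ℘[L] z - ℘[L] (z + c) with hw
  have Aw : AnalyticAt ℂ w a := (A0 a ha).sub (S0 a hb)
  have dw : deriv w =ᶠ[𝓝 a] fun z => ℘'[L] z - ℘'[L] (z + c) := by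
    filter_upwards [na, nb] with z hz hz'
    rw [hw, deriv_fun_sub (A0 z hz).differentiableAt (S0 z hz').differentiableAt,
      deriv_comp_add_const, L.deriv_weierstrassP]
  have ddw : deriv (deriv w) =ᶠ[𝓝 a] (fun z => 6 * (℘[L] z + ℘[L] (z + c))) * w := by
    filter_upwards [dw.eventuallyEq_nhds, na, nb] with z h hz hz'
    rw [h.deriv_eq, deriv_fun_sub (A1 z hz).differentiableAt (S1 z hz').differentiableAt,
      deriv_comp_add_const, second_ode L z hz, second_ode L _ hz']
    simp only [hw, Pi.mul_apply]
    ring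
  have o1 := Aw.analyticOrderAt_deriv_add_one
  have o2 := Aw.deriv.analyticOrderAt_deriv_add_one
  have wa : w a = 0 := by simp [hw, h0]
  have dwa : deriv w a = 0 := by rw [dw.eq_of_nhds]; simp [h1]
  simp only [wa, dwa, sub_zero] at o1 o2
  have Aq : AnalyticAt ℂ (fun z => 6 * (℘[L] z + ℘[L] (z + c))) a := by
    have h1 := A0 a ha
    have h2 := S0 a hb
    fun_prop
  rw [analyticOrderAt_congr ddw, analyticOrderAt_mul Aq Aw] at o2
  have top : analyticOrderAt w a = ⊤ := by
    by_contra hne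
    generalize analyticOrderAt (fun z => 6 * (℘[L] z + ℘[L] (z + c))) a = q at *
    change analyticOrderAt (deriv w) a + 1 = analyticOrderAt w a at o1
    rw [← ENat.natCast_toNat hne] at o1 o2
    change _ = analyticOrderAt (deriv w) a at o2
    rw [← o2] at o1
    generalize (analyticOrderAt w a).toNat = n at *
    cases q with
    | top => simp at o1
    | coe q => norm_cast at o1; omega
  rw [analyticOrderAt_eq_top] at top
  have eqo : Set.EqOn ℘[L] (fun z => ℘[L] (z + c)) Vᶜ := by
    refine AnalyticOnNhd.eqOn_of_preconnected_of_eventuallyEq (𝕜 := ℂ) (z₀ := a) ?_ ?_ hVp ?_ ?_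
    · intro x hx; exact A0 x (fun h => hx (Or.inl h))
    · intro x hx; exact S0 x (fun h => hx (Or.inr h))
    · rintro (h | h); exacts [ha h, hb h]
    · filter_upwards [top] with z hz using sub_eq_zero.mp hz
  refine not_analytic L _ (S0 0 (by simpa using hc)) ?_
  have nc : ∀ᶠ z in 𝓝 (0:ℂ), z + c ∉ L.lattice :=
    (continuous_add_const c).continuousAt.preimage_mem_nhds (hU.mem_nhds (by simpa using hc))
  filter_upwards [punct L, nhdsWithin_le_nhds nc] with z h1 h2
  apply eqo
  rintro (h | h); exacts [h1 h, h2 h]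

theorem half_deriv (L : PeriodPair) (a : ℂ) (h : 2 * a ∈ L.lattice) : ℘'[L] a = 0 := by
  have := L.derivWeierstrassP_sub_coe a ⟨2 * a, h⟩
  rw [show a - ((⟨2 * a, h⟩ : L.lattice) : ℂ) = -a by simp; ring, L.derivWeierstrassP_neg] at this
  exact self_eq_neg.mp this.symm

end MLam

namespace MLam

theorem wp_T (τ z : ℂ) : wp (τ + 1) z = wp τ z := by
  let e : ℤ × ℤ ≃ ℤ × ℤ :=
    { toFun p := (p.1 - p.2, p.2), invFun p := (p.1 + p.2, p.2)
      left_inv p := by simp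
      right_inv p := by simp }
  rw [wp, wp, ← e.tsum_eq]
  congr 1
  refine tsum_congr fun p => ?_
  have h : e p = 0 ↔ p = 0 := by
    rcases p with ⟨a, b⟩
    simp only [e, Equiv.coe_fn_mk, Prod.mk_eq_zero]
    constructor <;> rintro ⟨h1, h2⟩ <;> constructor <;> omega
  have h' : ((e p).1 : ℂ) + (e p).2 * (τ + 1) = (p.1 : ℂ) + p.2 * τ := by
    simp [e]; ring
  simp only [h, h']

theorem wp_S (τ z : ℂ) (hτ : τ ≠ 0) : wp (-1 / τ) z = τ ^ 2 * wp τ (τ * z) := by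
  let e : ℤ × ℤ ≃ ℤ × ℤ :=
    { toFun p := (-p.2, p.1), invFun p := (p.2, -p.1)
      left_inv p := by simp
      right_inv p := by simp }
  rw [wp, wp, mul_add, ← tsum_mul_left, ← e.tsum_eq (fun p : ℤ × ℤ => τ ^ 2 * _)]
  congr 1
  · rw [mul_pow]; field_simp
  refine tsum_congr fun p => ?_
  have h : e p = 0 ↔ p = 0 := by
    rcases p with ⟨a, b⟩
    simp only [e, Equiv.coe_fn_mk, Prod.mk_eq_zero]
    constructor <;> rintro ⟨h1, h2⟩ <;> constructor <;> omega
  have h' : (p.1 : ℂ) + p.2 * (-1 / τ) = (((e p).1 : ℂ) + (e p).2 * τ) / τ := by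
    simp [e]; field_simp; ring
  simp only [h, h']
  split_ifs
  · simp
  · generalize ((e p).1 : ℂ) + (e p).2 * τ = w
    rw [show z - w / τ = (τ * z - w) / τ by field_simp, div_pow, div_pow, one_div_div, one_div_div]
    ring

/-- algebraic core -/
theorem core (e1 e2 e3 g2 g3 : ℂ) (h12 : e1 ≠ e2) (h13 : e1 ≠ e3) (h23 : e2 ≠ e3)
    (r1 : 4 * e1 ^ 3 - g2 * e1 - g3 = 0) (r2 : 4 * e2 ^ 3 - g2 * e2 - g3 = 0)
    (r3 : 4 * e3 ^ 3 - g2 * e3 - g3 = 0) :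
    e1 + e2 + e3 = 0 ∧ g2 = 4 * (e1 ^ 2 + e1 * e2 + e2 ^ 2) ∧
      g3 = -4 * (e1 * e2 * (e1 + e2)) := by
  have a : 4 * (e1 ^ 2 + e1 * e2 + e2 ^ 2) - g2 = 0 := by
    apply mul_left_cancel₀ (sub_ne_zero.mpr h12); linear_combination r1 - r2
  have b : 4 * (e1 ^ 2 + e1 * e3 + e3 ^ 2) - g2 = 0 := by
    apply mul_left_cancel₀ (sub_ne_zero.mpr h13); linear_combination r1 - r3
  have c : e1 + e2 + e3 = 0 := by
    apply mul_left_cancel₀ (sub_ne_zero.mpr h23); linear_combination (a - b) / 4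
  refine ⟨c, by linear_combination -a, by linear_combination - r1 + e1 * a⟩

theorem six (l m : ℂ) (hm : m ≠ 0) (hm1 : m ≠ 1)
    (h : (l ^ 2 - l + 1) ^ 3 * (m ^ 2 * (1 - m) ^ 2) = (m ^ 2 - m + 1) ^ 3 * (l ^ 2 * (1 - l) ^ 2)) :
    m = l ∨ m = 1 - l ∨ m = l⁻¹ ∨ m = 1 - l⁻¹ ∨ m = (1 - l)⁻¹ ∨ m = 1 - (1 - l)⁻¹ := by
  have hm1' : 1 - m ≠ 0 := sub_ne_zero.mpr (Ne.symm hm1)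
  have hl : l ≠ 0 ∧ 1 - l ≠ 0 := by
    constructor
    · rintro rfl
      apply hm1'; simpa [hm] using h
    · intro hl
      have : l = 1 := by linear_combination -hl
      subst this
      apply hm1'; simpa [hm] using h
  have h' : (m - l) * (m - (1 - l)) * (m * l - 1) * (m * l - l + 1) * (m * (1 - l) - 1) *
      (m * (1 - l) + l) = 0 := by
    linear_combination -h
  obtain ⟨hl0, hl1⟩ := hl
  simp only [mul_eq_zero] at h'
  rcases h' with ((((h | h) | h) | h) | h) | h
  · left; linear_combination h
  · right; left; linear_combination h
  · right; right; left; field_simp; linear_combination h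
  · right; right; right; left; field_simp; linear_combination h
  · right; right; right; right; left; field_simp; linear_combination h
  · right; right; right; right; right; field_simp; linear_combination h

end MLam

namespace MLam
open PeriodPair Filter Topology UpperHalfPlane EisensteinSeries ModularForm ModularFormClass MatrixGroups

noncomputable def pp (τ : ℍ) : PeriodPair where
  ω₁ := 1
  ω₂ := τ
  indep := by
    rw [LinearIndependent.pair_iff]
    intro s t h
    have hi := congrArg Complex.im h
    have hr := congrArg Complex.re h
    have := τ.im_ne_zero
    simp at hi hr
    have ht : t = 0 := by tauto
    subst ht
    simpa using hr

theorem wp_eq (τ : ℍ) (z : ℂ) : wp τ z = ℘[pp τ] z := by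
  have hs := (pp τ).latticeEquivProd.symm.toEquiv.summable_iff.mpr ((pp τ).hasSum_weierstrassP z).summable
  rw [weierstrassP, ← (pp τ).latticeEquivProd.symm.toEquiv.tsum_eq]
  have h := hs.tsum_eq_add_tsum_ite 0
  simp only [Function.comp_def] at h
  rw [h, wp]
  have h' : ∀ n, (((pp τ).latticeEquivProd.symm n : (pp τ).lattice) : ℂ) = n.1 + n.2 * τ := fun n => by
    have := (pp τ).latticeEquiv_symm_apply n
    simpa [pp] using this
  simp [h']

theorem G_eq (τ : ℍ) (k : ℕ) (hk : 3 ≤ k) : (pp τ).G k = 2 * riemannZeta k * E hk τ := by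
  have h2 := tsum_eisSummand_eq_riemannZeta_mul_eisensteinSeries hk τ
  have h3 : E hk τ = (1 / 2 : ℂ) • eisensteinSeriesSIF (N := 1) 0 k τ := rfl
  rw [eisensteinSeriesSIF_apply] at h3
  rw [h3, smul_eq_mul]
  trans ∑' v : Fin 2 → ℤ, eisSummand k v τ
  · rw [G, ← ((finTwoArrowEquiv ℤ).trans ((Equiv.prodComm _ _).trans
      (pp τ).latticeEquivProd.symm.toEquiv)).tsum_eq]
    refine tsum_congr fun v => ?_
    have := (pp τ).latticeEquiv_symm_apply (v 1, v 0)
    change (((pp τ).latticeEquivProd.symm (v 1, v 0)).1 ^ k)⁻¹ = _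
    rw [this]
    simp [eisSummand, pp, add_comm]
  · rw [h2]; ring

theorem zeta_ne (k : ℕ) (hk : 3 ≤ k) : riemannZeta k ≠ 0 := by
  apply riemannZeta_ne_zero_of_one_le_re
  simp; omega

noncomputable def F (a b : ℂ) : ModularForm 𝒮ℒ 12 :=
  a • ModularForm.mcast (by decide) (E₄.pow 3) + b • ModularForm.mcast (by decide) (E₆.pow 2)

theorem F_apply (a b : ℂ) (z : ℍ) : F a b z = a * E₄ z ^ 3 + b * E₆ z ^ 2 := by
  have h4 : (E₄.pow 3) z = E₄ z ^ 3 := by rw [ModularForm.coe_pow]; rfl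
  have h6 : (E₆.pow 2) z = E₆ z ^ 2 := by rw [ModularForm.coe_pow]; rfl
  simp [F, h4, h6]

theorem E_tendsto {k : ℕ} (hk : 3 ≤ k) (hk2 : Even k) : Tendsto (E hk) atImInfty (𝓝 1) := by
  obtain ⟨c, hc, h⟩ := ModularFormClass.exp_decay_sub_atImInfty' (E hk)
  have hv : valueAtInfty (E hk) = 1 := by
    rw [← E_qExpansion_coeff_zero hk hk2]
    exact (UpperHalfPlane.qExpansion_coeff_zero one_pos
      (ModularFormClass.analyticAt_cuspFunction_zero (E hk) one_pos one_mem_strictPeriods_SL)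
      (SlashInvariantFormClass.periodic_comp_ofComplex (E hk) one_mem_strictPeriods_SL)).symm
  rw [hv] at h
  have : Tendsto (fun τ : ℍ ↦ Real.exp (-c * τ.im)) atImInfty (𝓝 0) := by
    refine Real.tendsto_exp_atBot.comp ?_
    exact (tendsto_comap).const_mul_atTop_of_neg (by linarith)
  simpa using (h.trans_tendsto this).add_const 1

theorem F_zero (a b : ℂ) (hab : a + b ≠ 0) : ∃ z : ℍ, F a b z = 0 := by
  by_contra! hne
  have ht : Tendsto (F a b) atImInfty (𝓝 (a + b)) := by
    have h4 := E_tendsto (k := 4) (by norm_num) ⟨2, rfl⟩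
    have h6 := E_tendsto (k := 6) (by norm_num) ⟨3, rfl⟩
    have := ((h4.pow 3).const_mul a).add ((h6.pow 2).const_mul b)
    simp only [one_pow, mul_one] at this
    exact this.congr (fun z => (F_apply a b z).symm)
  have hq : Tendsto (fun z => discriminant z / F a b z) atImInfty (𝓝 0) := by
    have : Tendsto discriminant atImInfty (𝓝 0) := discriminant_isZeroAtImInfty
    simpa [Pi.div_def] using this.div ht hab
  have hs (γ : SL(2, ℤ)) : (fun z ↦ discriminant z / F a b z) ∣[(0:ℤ)] γ =
      fun z ↦ discriminant z / F a b z := by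
    have hγ : (γ : GL (Fin 2) ℝ) ∈ 𝒮ℒ := ⟨γ, rfl⟩
    change (⇑CuspForm.discriminant / ⇑(F a b)) ∣[(12:ℤ) - 12] γ = ⇑CuspForm.discriminant / ⇑(F a b)
    simp_rw [div_slash_SL2, SL_slash, SlashInvariantForm.slash_action_eqn _ _ hγ]
  let q : ModularForm 𝒮ℒ 0 :=
    { toFun z := discriminant z / F a b z
      slash_action_eq' := fun _ ⟨γ, hγ⟩ ↦ hγ ▸ hs γ
      holo' := CuspForm.discriminant.holo'.div (F a b).holo' hne
      bdd_at_cusps' {c} hc := by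
        rw [Subgroup.IsArithmetic.isCusp_iff_isCusp_SL2Z] at hc
        rw [OnePoint.isBoundedAt_iff_forall_SL2Z hc]
        intro γ _
        rw [hs γ, IsBoundedAtImInfty, BoundedAtFilter]
        exact hq.isBigO_one ℝ }
  obtain ⟨c, hc⟩ := ModularFormClass.levelOne_weight_zero_const q
  have hc' : ∀ z, discriminant z / F a b z = c := fun z => congrFun hc z
  have hc0 : c = 0 := by
    simp only [hc'] at hq
    exact tendsto_nhds_unique tendsto_const_nhds hq
  have := hc' I
  rw [hc0, div_eq_zero_iff] at this
  exact this.elim (discriminant_ne_zero _) (hne _)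

end MLam

namespace MLam
open PeriodPair UpperHalfPlane EisensteinSeries ModularForm

theorem mem_iff (τ : ℍ) (a b : ℝ) :
    ((a : ℂ) + b * (τ : ℂ)) ∈ (pp τ).lattice ↔ (∃ m : ℤ, a = m) ∧ ∃ n : ℤ, b = n := by
  rw [PeriodPair.mem_lattice]
  have ht := τ.im_ne_zero
  constructor
  · rintro ⟨m, n, h⟩
    have hi := congrArg Complex.im h
    have hr := congrArg Complex.re h
    simp [pp] at hi hr
    have hb : b = n := by tauto
    subst hb
    exact ⟨⟨m, by linarith⟩, n, rfl⟩
  · rintro ⟨⟨m, rfl⟩, n, rfl⟩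
    exact ⟨m, n, by simp [pp]⟩

theorem not_half (m : ℤ) : (1/2 : ℝ) ≠ m := by
  intro h
  have : (1 : ℝ) = ((2 * m : ℤ) : ℝ) := by push_cast; linarith
  have : (1 : ℤ) = 2 * m := by exact_mod_cast this
  omega

theorem nm1 (τ : ℍ) : (1 / 2 : ℂ) ∉ (pp τ).lattice := by
  have := mem_iff τ (1/2) 0
  simp only [Complex.ofReal_zero, zero_mul, add_zero, not_half] at this
  push_cast at this
  simp only [this]; simp [not_half]

theorem nm3 (τ : ℍ) : (τ / 2 : ℂ) ∉ (pp τ).lattice := by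
  intro h
  have := (mem_iff τ 0 (1/2)).mp (by convert h using 1; push_cast; ring)
  obtain ⟨_, n, hn⟩ := this
  exact not_half n hn

theorem nm2 (τ : ℍ) : ((1 + τ) / 2 : ℂ) ∉ (pp τ).lattice := by
  intro h
  have := (mem_iff τ (1/2) (1/2)).mp (by convert h using 1; push_cast; ring)
  obtain ⟨_, n, hn⟩ := this
  exact not_half n hn

theorem nm4 (τ : ℍ) : ((τ - 1) / 2 : ℂ) ∉ (pp τ).lattice := by
  intro h
  have := (mem_iff τ (-1/2) (1/2)).mp (by convert h using 1; push_cast; ring)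
  obtain ⟨_, n, hn⟩ := this
  exact not_half n hn

theorem one_mem (τ : ℍ) : (1 : ℂ) ∈ (pp τ).lattice := by
  have := (mem_iff τ 1 0).mpr ⟨⟨1, by simp⟩, 0, by simp⟩
  simpa using this

theorem tau_mem (τ : ℍ) : (τ : ℂ) ∈ (pp τ).lattice := by
  have := (mem_iff τ 0 1).mpr ⟨⟨0, by simp⟩, 1, by simp⟩
  simpa using this

theorem d1 (τ : ℍ) : ℘'[pp τ] (1 / 2) = 0 := by
  apply half_deriv
  convert one_mem τ using 1; norm_num

theorem d2 (τ : ℍ) : ℘'[pp τ] ((1 + τ) / 2) = 0 := by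
  apply half_deriv
  convert add_mem (one_mem τ) (tau_mem τ) using 1; ring

theorem d3 (τ : ℍ) : ℘'[pp τ] (τ / 2) = 0 := by
  apply half_deriv
  convert tau_mem τ using 1; ring

theorem ne12 (τ : ℍ) : e1 τ ≠ e2 τ := by
  intro h
  rw [e1, e2, wp_eq, wp_eq] at h
  have e : (1 / 2 + τ / 2 : ℂ) = (1 + τ) / 2 := by ring
  refine inj (pp τ) (1/2) (τ / 2) (nm1 τ) (by rw [e]; exact nm2 τ) (nm3 τ) (by rw [e]; exact h) ?_
  rw [e, d1, d2]

theorem ne32 (τ : ℍ) : e3 τ ≠ e2 τ := by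
  intro h
  rw [e3, e2, wp_eq, wp_eq] at h
  have e : (τ / 2 + 1 / 2 : ℂ) = (1 + τ) / 2 := by ring
  refine inj (pp τ) (τ / 2) (1/2) (nm3 τ) (by rw [e]; exact nm2 τ) (nm1 τ) (by rw [e]; exact h) ?_
  rw [e, d3, d2]

theorem ne13 (τ : ℍ) : e1 τ ≠ e3 τ := by
  intro h
  rw [e1, e3, wp_eq, wp_eq] at h
  have e : (1 / 2 + (τ - 1) / 2 : ℂ) = τ / 2 := by ring
  refine inj (pp τ) (1 / 2) ((τ - 1)/2) (nm1 τ) (by rw [e]; exact nm3 τ) (nm4 τ) (by rw [e]; exact h) ?_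
  rw [e, d1, d3]

theorem root (τ : ℍ) (z : ℂ) (hz : z ∉ (pp τ).lattice) (h : ℘'[pp τ] z = 0) :
    4 * wp τ z ^ 3 - (pp τ).g₂ * wp τ z - (pp τ).g₃ = 0 := by
  have := (pp τ).derivWeierstrassP_sq z hz
  rw [h] at this
  rw [wp_eq]
  linear_combination -this

theorem rel (τ : ℍ) : e1 τ + e2 τ + e3 τ = 0 ∧
    (pp τ).g₂ = 4 * (e1 τ ^ 2 + e1 τ * e2 τ + e2 τ ^ 2) ∧
      (pp τ).g₃ = -4 * (e1 τ * e2 τ * (e1 τ + e2 τ)) :=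
  core _ _ _ _ _ (ne12 τ) (ne13 τ) (ne32 τ).symm (root τ _ (nm1 τ) (d1 τ))
    (root τ _ (nm2 τ) (d2 τ)) (root τ _ (nm3 τ) (d3 τ))

theorem disc (τ : ℍ) : (pp τ).g₂ ^ 3 - 27 * (pp τ).g₃ ^ 2 =
    16 * ((e1 τ - e2 τ) * (e1 τ - e3 τ) * (e3 τ - e2 τ)) ^ 2 := by
  obtain ⟨h, h2, h3⟩ := rel τ
  have h' : e3 τ = - e1 τ - e2 τ := by linear_combination h
  rw [h2, h3, h']; ring

theorem disc_ne (τ : ℍ) : (pp τ).g₂ ^ 3 - 27 * (pp τ).g₃ ^ 2 ≠ 0 := by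
  rw [disc]
  have i1 := sub_ne_zero.mpr (ne12 τ)
  have i2 := sub_ne_zero.mpr (ne13 τ)
  have i3 := sub_ne_zero.mpr (ne32 τ)
  simp [i1, i2, i3]

theorem g_E : ∃ α β : ℂ, α ≠ 0 ∧ ∀ τ : ℍ, (pp τ).g₂ ^ 3 = α * E₄ τ ^ 3 ∧
    27 * (pp τ).g₃ ^ 2 = β * E₆ τ ^ 2 := by
  refine ⟨(60 * (2 * riemannZeta (4:ℕ))) ^ 3, 27 * (140 * (2 * riemannZeta (6:ℕ))) ^ 2, ?_, ?_⟩
  · have := zeta_ne 4 (by norm_num)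
    push_cast at this
    simp [this]
  · intro τ
    rw [PeriodPair.g₂, PeriodPair.g₃, G_eq τ 4 (by norm_num), G_eq τ 6 (by norm_num)]
    constructor
    · change _ = _ * (E (k := 4) (by norm_num) τ) ^ 3
      ring
    · change _ = _ * (E (k := 6) (by norm_num) τ) ^ 2
      ring

theorem exists_six (μ : ℂ) (h0 : μ ≠ 0) (h1 : μ ≠ 1) : ∃ τ : ℍ,
    (mlambda τ ^ 2 - mlambda τ + 1) ^ 3 * (μ ^ 2 * (1 - μ) ^ 2) =
      (μ ^ 2 - μ + 1) ^ 3 * (mlambda τ ^ 2 * (1 - mlambda τ) ^ 2) := by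
  obtain ⟨α, β, hα, hg⟩ := g_E
  have hαβ : α = β := by
    by_contra hne
    obtain ⟨z, hz⟩ := F_zero α (-β) (by rw [← sub_eq_add_neg]; exact sub_ne_zero.mpr hne)
    rw [F_apply] at hz
    apply disc_ne z
    rw [(hg z).1, (hg z).2]; linear_combination hz
  subst hαβ
  have h1' : 1 - μ ≠ 0 := sub_ne_zero.mpr (Ne.symm h1)
  obtain ⟨τ, hz⟩ := F_zero ((27 * (μ ^ 2 * (1 - μ) ^ 2) - 4 * (μ ^ 2 - μ + 1) ^ 3) * α)
    (4 * (μ ^ 2 - μ + 1) ^ 3 * α) (by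
      have : 27 * (μ ^ 2 * (1 - μ) ^ 2) * α ≠ 0 := by simp [h0, h1', hα]
      intro h; apply this; linear_combination h)
  refine ⟨τ, ?_⟩
  rw [F_apply] at hz
  have hP : 27 * (μ ^ 2 * (1 - μ) ^ 2) * (pp τ).g₂ ^ 3 -
      4 * (μ ^ 2 - μ + 1) ^ 3 * ((pp τ).g₂ ^ 3 - 27 * (pp τ).g₃ ^ 2) = 0 := by
    rw [(hg τ).1, (hg τ).2]; linear_combination hz
  rw [disc] at hP
  obtain ⟨hs, h2, -⟩ := rel τ
  have hd : e3 τ - e1 τ ≠ 0 := sub_ne_zero.mpr (ne13 τ).symm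
  set d := e3 τ - e1 τ with hdd
  set l := mlambda τ with hl
  have hl' : e2 τ - e1 τ = l * d := by rw [hl, mlambda, ← hdd, div_mul_cancel₀ _ hd]
  have k1 : e1 τ = -(l * d + d) / 3 := by linear_combination (hs - hl' + hdd) / 3
  have k2 : e2 τ = l * d -(l * d + d) / 3 := by linear_combination k1 + hl'
  have k3 : e3 τ = d -(l * d + d) / 3 := by linear_combination k1 - hdd
  rw [h2, k1, k2, k3] at hP
  have : 64 * d ^ 6 ≠ 0 := by simp [hd]
  apply mul_left_cancel₀ this
  linear_combination hP

def V (x : ℂ) : Prop := ∃ τ : ℍ, mlambda τ = x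

theorem V_inv {x : ℂ} (h : V x) : V x⁻¹ := by
  obtain ⟨τ, rfl⟩ := h
  refine ⟨⟨τ + 1, by simpa using τ.im_pos⟩, ?_⟩
  change mlambda ((τ : ℂ) + 1) = _
  have a1 : e1 ((τ : ℂ) + 1) = e1 τ := by rw [e1, wp_T, e1]
  have a3 : e3 ((τ : ℂ) + 1) = e2 τ := by rw [e3, wp_T, e2, add_comm]
  have a2 : e2 ((τ : ℂ) + 1) = e3 τ := by
    rw [e2, wp_T, e3, wp_eq, wp_eq, ← (pp τ).weierstrassP_add_coe (τ / 2) ⟨1, one_mem τ⟩]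
    congr 1; simp only; ring
  rw [mlambda, mlambda, a1, a2, a3, inv_div]

theorem V_sub {x : ℂ} (h : V x) : V (1 - x) := by
  obtain ⟨τ, rfl⟩ := h
  have ht : (τ : ℂ) ≠ 0 := τ.ne_zero
  refine ⟨⟨-1 / τ, ?_⟩, ?_⟩
  · have := UpperHalfPlane.im_inv_neg_coe_pos τ
    rwa [inv_neg, ← one_div, ← neg_div] at this
  change mlambda (-1 / (τ : ℂ)) = _
  have a1 : e1 (-1 / (τ : ℂ)) = τ ^ 2 * e3 τ := by
    rw [e1, wp_S _ _ ht, e3, mul_one_div]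
  have a3 : e3 (-1 / (τ : ℂ)) = τ ^ 2 * e1 τ := by
    rw [e3, wp_S _ _ ht, e1, wp_eq, wp_eq, ← (pp τ).weierstrassP_neg (1/2)]
    congr 2; field_simp
  have a2 : e2 (-1 / (τ : ℂ)) = τ ^ 2 * e2 τ := by
    rw [e2, wp_S _ _ ht, e2, wp_eq, wp_eq, ← (pp τ).weierstrassP_sub_coe ((1 + τ) / 2) ⟨1, one_mem τ⟩]
    congr 2; simp only; field_simp; ring
  have hd : e3 τ - e1 τ ≠ 0 := sub_ne_zero.mpr (ne13 τ).symm
  have hd' : e1 τ - e3 τ ≠ 0 := sub_ne_zero.mpr (ne13 τ)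
  rw [mlambda, mlambda, a1, a2, a3, ← mul_sub, ← mul_sub, mul_div_mul_left _ _ (pow_ne_zero 2 ht)]
  rw [eq_sub_iff_add_eq, div_add_div _ _ hd' hd, div_eq_one_iff_eq (mul_ne_zero hd' hd)]
  ring

theorem final (μ : ℂ) (h0 : μ ≠ 0) (h1 : μ ≠ 1) : ∃ τ : ℂ, 0 < τ.im ∧ mlambda τ = μ := by
  suffices h : V μ by
    obtain ⟨τ, h⟩ := h
    exact ⟨τ, τ.im_pos, h⟩
  obtain ⟨τ, h⟩ := exists_six μ h0 h1
  have hl : V (mlambda τ) := ⟨τ, rfl⟩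
  rcases six _ _ h0 h1 h with h | h | h | h | h | h <;> rw [h]
  · exact hl
  · exact V_sub hl
  · exact V_inv hl
  · exact V_sub (V_inv hl)
  · exact V_inv (V_sub hl)
  · exact V_sub (V_inv (V_sub hl))

end MLam

/-- The modular lambda function `λ : ℍ → ℂ∖{0,1}` is surjective: for
every complex number `μ ∉ {0, 1}` there is `τ` in the upper half-plane with `λ(τ) = μ`. -/
theorem mlambda_surjective (μ : ℂ) (h0 : μ ≠ 0) (h1 : μ ≠ 1) :
    ∃ τ : ℂ, 0 < τ.im ∧ mlambda τ = μ := by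
  exact MLam.final μ h0 h1
end

section
/- For every τ in the complex upper half-plane ℍ and every pair (x, y) ∈ ℂ² satisfying y² = 4x³ − g₂(τ)x − g₃(τ), there exists a unique z in the fundamental parallelogram L_τ = {s + tτ : s, t ∈ [0,1)} with z ≠ 0 such that ℘(z;τ) = x and ℘′(z;τ) = y. In other words, z ↦ (℘(z;τ), ℘′(z;τ)) is a bijection from L_τ∖{0} onto the affine complex points of the curve y² = 4x³ − g₂(τ)x − g₃(τ). -/
open Filter Topology

namespace WPU

lemma tendsto_P (L : PeriodPair) (l : ℂ) (hl : l ∈ L.lattice) :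
    Tendsto L.weierstrassP (𝓝[≠] l) (Bornology.cobounded ℂ) := by
  apply tendsto_cobounded_of_meromorphicOrderAt_neg
  rw [L.order_weierstrassP l hl]
  exact WithTop.coe_lt_coe.mpr (by norm_num : (-2 : ℤ) < 0)

lemma countable_lattice (L : PeriodPair) : (L.lattice : Set ℂ).Countable :=
  countable_of_Lindelof_of_discrete (X := L.lattice)

lemma preconn (s : Set ℂ) (hs : s.Countable) : IsPreconnected sᶜ :=
  (Set.Countable.isConnected_compl_of_one_lt_rank (by simp) hs).2

lemma eventually_notMem (L : PeriodPair) (l : ℂ) : ∀ᶠ z in 𝓝[≠] l, z ∉ L.lattice := by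
  filter_upwards [self_mem_nhdsWithin, mem_nhdsWithin_of_mem_nhds
    (L.compl_lattice_sdiff_singleton_mem_nhds l)] with z h1 h2 h3
  exact h2 ⟨h3, h1⟩

lemma not_const (L : PeriodPair) (x c : ℂ) (hx : x ∈ L.lattice) (g : ℂ → ℂ)
    (hg : Tendsto g (𝓝[≠] x) (𝓝 c)) (h : ∀ᶠ z in 𝓝[≠] x, L.weierstrassP z = g z) : False := by
  have h1 := (tendsto_P L x hx).congr' h
  rw [← tendsto_norm_atTop_iff_cobounded] at h1
  exact not_tendsto_atTop_of_tendsto_nhds hg.norm h1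

/-- `℘'' = 6 ℘² - g₂/2`. -/
lemma deriv2 (L : PeriodPair) (z : ℂ) (hz : z ∉ L.lattice) :
    deriv L.derivWeierstrassP z = 6 * L.weierstrassP z ^ 2 - L.g₂ / 2 := by
  have hU : IsOpen (L.lattice : Set ℂ)ᶜ := L.isClosed_lattice.isOpen_compl
  have hP := L.analyticOnNhd_weierstrassP
  have hP' := L.analyticOnNhd_derivWeierstrassP
  have key := AnalyticOnNhd.eq_zero_or_eq_zero_of_mul_eq_zero (𝕜 := ℂ) (A := ℂ)
    (f := L.derivWeierstrassP)
    (g := fun z => deriv L.derivWeierstrassP z - (6 * L.weierstrassP z ^ 2 - L.g₂ / 2))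
    (U := (L.lattice : Set ℂ)ᶜ) hP'
    (fun w hw => by
      have h1 := hP w hw
      have h2 := (hP' w hw).deriv
      fun_prop)
    (fun w hw => by
      have h1 : HasDerivAt L.weierstrassP (L.derivWeierstrassP w) w := by
        rw [← L.deriv_weierstrassP]; exact (hP w hw).differentiableAt.hasDerivAt
      have h2 := (hP' w hw).differentiableAt.hasDerivAt
      have h3 : (fun z => L.derivWeierstrassP z ^ 2) =ᶠ[𝓝 w]
          fun z => 4 * L.weierstrassP z ^ 3 - L.g₂ * L.weierstrassP z - L.g₃ := by
        filter_upwards [hU.mem_nhds hw] with z hz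
        exact L.derivWeierstrassP_sq z hz
      have h4 := (h2.pow 2).unique (HasDerivAt.congr_of_eventuallyEq
        ((((h1.pow 3).const_mul 4).sub (h1.const_mul L.g₂)).sub_const L.g₃) h3)
      norm_num at h4
      linear_combination h4 / 2) (preconn _ (countable_lattice L))
  rcases key with key | key
  · exfalso
    obtain ⟨c, hc⟩ := hU.exists_is_const_of_deriv_eq_zero (preconn _ (countable_lattice L))
      L.differentiableOn_weierstrassP (fun w hw => by
        rw [L.deriv_weierstrassP]; exact key w hw)
    refine not_const L 0 c L.lattice.zero_mem (fun _ => c) tendsto_const_nhds ?_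
    filter_upwards [eventually_notMem L 0] with w hw
    exact hc w hw
  · exact sub_eq_zero.mp (key z hz)

lemma ode_unique (f g f' g' : ℂ → ℂ) (k x : ℂ) (hf : AnalyticAt ℂ f x) (hg : AnalyticAt ℂ g x)
    (hf1 : ∀ᶠ z in 𝓝 x, HasDerivAt f (f' z) z) (hg1 : ∀ᶠ z in 𝓝 x, HasDerivAt g (g' z) z)
    (hf2 : ∀ᶠ z in 𝓝 x, HasDerivAt f' (6 * f z ^ 2 - k) z)
    (hg2 : ∀ᶠ z in 𝓝 x, HasDerivAt g' (6 * g z ^ 2 - k) z)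
    (h0 : f x = g x) (h1 : f' x = g' x) : f =ᶠ[𝓝 x] g := by
  have hh : AnalyticAt ℂ (f - g) x := hf.sub hg
  have e1 : deriv (f - g) =ᶠ[𝓝 x] f' - g' := by
    filter_upwards [hf1, hg1] with z a b
    exact (a.sub b).deriv
  have hh' : AnalyticAt ℂ (f' - g') x := hh.deriv.congr e1
  have e2 : deriv (f' - g') =ᶠ[𝓝 x] (f - g) * fun z => 6 * (f z + g z) := by
    filter_upwards [hf2, hg2] with z a b
    rw [(a.sub b).deriv]
    simp only [Pi.mul_apply, Pi.sub_apply]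
    ring
  have o1 := hh.analyticOrderAt_deriv_add_one
  have o2 := hh'.analyticOrderAt_deriv_add_one
  have s1 : (fun z => (f - g) z - (f - g) x) = f - g := by ext z; simp [h0]
  have s2 : (fun z => (f' - g') z - (f' - g') x) = f' - g' := by ext z; simp [h1]
  rw [s1, analyticOrderAt_congr e1] at o1
  rw [s2, analyticOrderAt_congr e2, analyticOrderAt_mul hh (by fun_prop)] at o2
  have htop : analyticOrderAt (f - g) x = ⊤ := by
    by_contra hne
    rw [← o2] at o1
    generalize analyticOrderAt (f - g) x = n at *
    generalize analyticOrderAt (fun z => 6 * (f z + g z)) x = m at *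
    lift n to ℕ using hne
    cases m with
    | top => simp at o1
    | coe m => norm_cast at o1; omega
  filter_upwards [analyticOrderAt_eq_top.mp htop] with z hz
  exact sub_eq_zero.mp hz

lemma inj (L : PeriodPair) (a b : ℂ) (ha : a ∉ L.lattice) (hb : b ∉ L.lattice)
    (h0 : L.weierstrassP a = L.weierstrassP b)
    (h1 : L.derivWeierstrassP a = L.derivWeierstrassP b) : b - a ∈ L.lattice := by
  by_contra hl
  set l := b - a with hldef
  have hU : IsOpen (L.lattice : Set ℂ)ᶜ := L.isClosed_lattice.isOpen_compl
  have hP := L.analyticOnNhd_weierstrassP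
  have hP' := L.analyticOnNhd_derivWeierstrassP
  have dP : ∀ z ∉ L.lattice, HasDerivAt L.weierstrassP (L.derivWeierstrassP z) z := by
    intro z hz
    rw [← L.deriv_weierstrassP]; exact (hP z hz).differentiableAt.hasDerivAt
  have dP' : ∀ z ∉ L.lattice,
      HasDerivAt L.derivWeierstrassP (6 * L.weierstrassP z ^ 2 - L.g₂ / 2) z := by
    intro z hz
    rw [← deriv2 L z hz]; exact (hP' z hz).differentiableAt.hasDerivAt
  have ab : a + l = b := by simp [hldef]
  have cont : Continuous (fun z : ℂ => z + l) := by fun_prop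
  have hV : IsOpen ((fun z : ℂ => z + l) ⁻¹' (L.lattice : Set ℂ)ᶜ) := hU.preimage cont
  have an2 : ∀ z, z + l ∉ L.lattice → AnalyticAt ℂ (fun z => L.weierstrassP (z + l)) z := by
    intro z hz
    exact (hP (z + l) hz).fun_comp (f := fun z => z + l) (by fun_prop)
  have hbl : a + l ∉ L.lattice := by rwa [ab]
  have loc : L.weierstrassP =ᶠ[𝓝 a] fun z => L.weierstrassP (z + l) := by
    refine ode_unique _ _ L.derivWeierstrassP (fun z => L.derivWeierstrassP (z + l)) (L.g₂ / 2) a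
      (hP a ha) (an2 a hbl) ?_ ?_ ?_ ?_ (by simpa [ab] using h0) (by simpa [ab] using h1)
    · filter_upwards [hU.mem_nhds ha] with z hz using dP z hz
    · filter_upwards [hV.mem_nhds hbl] with z hz using (dP (z + l) hz).comp_add_const z l
    · filter_upwards [hU.mem_nhds ha] with z hz using dP' z hz
    · filter_upwards [hV.mem_nhds hbl] with z hz using (dP' (z + l) hz).comp_add_const z l
  set S : Set ℂ := (L.lattice : Set ℂ) ∪ (fun z : ℂ => z + l) ⁻¹' (L.lattice : Set ℂ) with hS
  have hSc : S.Countable := (countable_lattice L).union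
    ((countable_lattice L).preimage (add_left_injective l))
  have glob : Set.EqOn L.weierstrassP (fun z => L.weierstrassP (z + l)) Sᶜ := by
    refine AnalyticOnNhd.eqOn_of_preconnected_of_eventuallyEq (𝕜 := ℂ) (z₀ := a) ?_ ?_
      (preconn S hSc) ?_ loc
    · intro z hz
      exact hP z (fun h => hz (Or.inl h))
    · intro z hz
      exact an2 z (fun h => hz (Or.inr h))
    · rintro (h | h)
      · exact ha h
      · exact hbl h
  have hl0 : (0 : ℂ) + l ∉ L.lattice := by simpa using hl
  refine not_const L 0 (L.weierstrassP (0 + l)) L.lattice.zero_mem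
    (fun z => L.weierstrassP (z + l))
    ((an2 0 hl0).continuousAt.tendsto.mono_left nhdsWithin_le_nhds) ?_
  filter_upwards [eventually_notMem L 0, mem_nhdsWithin_of_mem_nhds (hV.mem_nhds hl0)] with z h1 h2
  apply glob
  rintro (h | h)
  · exact h1 h
  · exact h2 h

open Classical in
lemma surj (L : PeriodPair) (x : ℂ) : ∃ z, z ∉ L.lattice ∧ L.weierstrassP z = x := by
  by_contra! hne
  have hU : IsOpen (L.lattice : Set ℂ)ᶜ := L.isClosed_lattice.isOpen_compl
  let f : ℂ → ℂ := fun z => if z ∈ L.lattice then 0 else (L.weierstrassP z - x)⁻¹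
  have hfoff : ∀ z ∉ L.lattice, DifferentiableAt ℂ f z := by
    intro z hz
    have h1 : DifferentiableAt ℂ (fun z => (L.weierstrassP z - x)⁻¹) z :=
      (((L.analyticOnNhd_weierstrassP z hz).differentiableAt).sub_const x).inv
        (sub_ne_zero.mpr (hne z hz))
    refine h1.congr_of_eventuallyEq ?_
    filter_upwards [hU.mem_nhds hz] with w hw
    exact if_neg hw
  have hd : Differentiable ℂ f := by
    intro z
    by_cases hz : z ∈ L.lattice
    · have hs := L.compl_lattice_sdiff_singleton_mem_nhds z
      refine ((Complex.differentiableOn_compl_singleton_and_continuousAt_iff hs).mp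
        ⟨?_, ?_⟩).differentiableAt hs
      · rintro w ⟨hw1, hw2⟩
        exact (hfoff w (fun h => hw1 ⟨h, hw2⟩)).differentiableWithinAt
      · rw [continuousAt_iff_punctured_nhds]
        have : f z = 0 := if_pos hz
        rw [this]
        have t : Tendsto (fun w => (L.weierstrassP w - x)⁻¹) (𝓝[≠] z) (𝓝 0) := by
          refine Filter.tendsto_inv₀_cobounded.comp ?_
          have := tendsto_P L z hz
          rw [← tendsto_norm_atTop_iff_cobounded] at this ⊢
          refine tendsto_atTop_mono (fun w => norm_sub_norm_le _ _)
            (tendsto_atTop_add_const_right _ (-‖x‖) this)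
        refine t.congr' ?_
        filter_upwards [eventually_notMem L z] with w hw
        exact (if_neg hw).symm
    · exact hfoff z hz
  have hconst := fun z => hd.apply_eq_apply_of_bounded
    (IsZLattice.isCompact_range_of_periodic L.lattice f hd.continuous fun z w hw ↦ by
      have : z + w ∈ L.lattice ↔ z ∈ L.lattice := L.lattice.add_mem_iff_left hw
      lift w to L.lattice using hw
      simp [f, this]).isBounded z 0
  have h0 : f 0 = 0 := if_pos L.lattice.zero_mem
  have h1 := hconst (L.ω₁ / 2)
  rw [h0] at h1
  have h2 : f (L.ω₁ / 2) = (L.weierstrassP (L.ω₁ / 2) - x)⁻¹ := if_neg L.ω₁_div_two_notMem_lattice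
  rw [h2, inv_eq_zero, sub_eq_zero] at h1
  exact hne _ L.ω₁_div_two_notMem_lattice h1

/-- The period pair `(1, τ)`. -/
noncomputable def pp (τ : ℂ) (hτ : 0 < τ.im) : PeriodPair where
  ω₁ := 1
  ω₂ := τ
  indep := by
    rw [LinearIndependent.pair_iff]
    intro s t h
    have him := congrArg Complex.im h
    have hre := congrArg Complex.re h
    simp at him hre
    rcases him with h | h
    · subst h; simpa using hre
    · exact absurd h hτ.ne'

lemma tsum_eq (τ : ℂ) (hτ : 0 < τ.im) (F : ℂ → ℂ) :
    ∑' l : (pp τ hτ).lattice, F l = ∑' p : ℤ × ℤ, F ((p.1 : ℂ) + (p.2 : ℂ) * τ) := by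
  rw [← (pp τ hτ).latticeEquivProd.symm.toEquiv.tsum_eq]
  refine tsum_congr fun p => ?_
  have := (pp τ hτ).latticeEquiv_symm_apply p
  simp only [LinearEquiv.coe_toEquiv]
  rw [this]
  simp [pp]

lemma wp_eq (τ : ℂ) (hτ : 0 < τ.im) : wp τ = (pp τ hτ).weierstrassP := by
  ext z
  have hs := ((pp τ hτ).hasSum_weierstrassP z).summable
  rw [← (pp τ hτ).weierstrassPExcept_add 0 z, PeriodPair.weierstrassPExcept, wp]
  have := tsum_eq τ hτ (fun l => if l = 0 then 0 else (1 / (z - l) ^ 2 - 1 / l ^ 2))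
  simp only [ZeroMemClass.coe_zero] at this ⊢
  rw [this, add_comm]
  congr 1
  · refine tsum_congr fun p => ?_
    by_cases hp : p = 0
    · simp [hp]
    · rw [if_neg hp, if_neg]
      intro h
      apply hp
      have h1 := (pp τ hτ).latticeEquiv_symm_apply p
      have h2 : ((pp τ hτ).latticeEquivProd.symm p).1 = 0 := by
        rw [h1]; simpa [pp] using h
      simpa using h2
  · simp

lemma g2_eq (τ : ℂ) (hτ : 0 < τ.im) : g2 τ = (pp τ hτ).g₂ := by
  rw [g2, PeriodPair.g₂, PeriodPair.G, tsum_eq τ hτ (fun l => (l ^ 4)⁻¹)]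
  congr 1
  refine tsum_congr fun p => ?_
  by_cases hp : p = 0 <;> simp [hp]

lemma g3_eq (τ : ℂ) (hτ : 0 < τ.im) : g3 τ = (pp τ hτ).g₃ := by
  rw [g3, PeriodPair.g₃, PeriodPair.G, tsum_eq τ hτ (fun l => (l ^ 6)⁻¹)]
  congr 1
  refine tsum_congr fun p => ?_
  by_cases hp : p = 0 <;> simp [hp]

lemma coord (τ : ℂ) (hτ : 0 < τ.im) (s t s' t' : ℝ)
    (h : (s : ℂ) + t * τ = s' + t' * τ) : s = s' ∧ t = t' := by
  have him := congrArg Complex.im h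
  have hre := congrArg Complex.re h
  simp at him hre
  rcases him with h | h
  · subst h; simpa using hre
  · exact absurd h hτ.ne'

lemma fund_unique (τ : ℂ) (hτ : 0 < τ.im) (s t s' t' : ℝ)
    (hs : s ∈ Set.Ico (0 : ℝ) 1) (ht : t ∈ Set.Ico (0 : ℝ) 1)
    (hs' : s' ∈ Set.Ico (0 : ℝ) 1) (ht' : t' ∈ Set.Ico (0 : ℝ) 1)
    (h : ((s' : ℂ) + t' * τ) - (s + t * τ) ∈ (pp τ hτ).lattice) : s = s' ∧ t = t' := by
  obtain ⟨m, n, hmn⟩ := PeriodPair.mem_lattice.mp h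
  obtain ⟨h1, h2⟩ := coord τ hτ (s + m) (t + n) s' t' (by
    simp only [pp, mul_one] at hmn
    push_cast
    linear_combination hmn)
  have hm : m = 0 := by
    have a : (m : ℝ) < 1 := by linarith [hs.1, hs'.2]
    have b : (-1 : ℝ) < m := by linarith [hs.2, hs'.1]
    have a' : m < 1 := by exact_mod_cast a
    have b' : -1 < m := by exact_mod_cast b
    omega
  have hn : n = 0 := by
    have a : (n : ℝ) < 1 := by linarith [ht.1, ht'.2]
    have b : (-1 : ℝ) < n := by linarith [ht.2, ht'.1]
    have a' : n < 1 := by exact_mod_cast a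
    have b' : -1 < n := by exact_mod_cast b
    omega
  subst hm hn
  constructor
  · simpa using h1
  · simpa using h2

lemma fund_exists (τ : ℂ) (hτ : 0 < τ.im) (z : ℂ) : ∃ s t : ℝ, s ∈ Set.Ico (0 : ℝ) 1 ∧
    t ∈ Set.Ico (0 : ℝ) 1 ∧ ∃ l ∈ (pp τ hτ).lattice, (s : ℂ) + t * τ = z + l := by
  set t := z.im / τ.im with ht
  set s := z.re - t * τ.re with hs
  have hz : z = s + t * τ := by
    apply Complex.ext
    · simp [hs]
    · simp [ht, hτ.ne']
  refine ⟨Int.fract s, Int.fract t, ⟨Int.fract_nonneg s, Int.fract_lt_one s⟩,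
    ⟨Int.fract_nonneg t, Int.fract_lt_one t⟩, -(⌊s⌋ + ⌊t⌋ * τ), ?_, ?_⟩
  · refine PeriodPair.mem_lattice.mpr ⟨-⌊s⌋, -⌊t⌋, ?_⟩
    simp only [pp]
    push_cast
    ring
  · have h1 : ((Int.fract s : ℝ) : ℂ) = s - ⌊s⌋ := by
      rw [Int.fract]; push_cast; rfl
    have h2 : ((Int.fract t : ℝ) : ℂ) = t - ⌊t⌋ := by
      rw [Int.fract]; push_cast; rfl
    rw [h1, h2, hz]
    ring

end WPU

/-- For every `τ` in the upper half-plane and every `(x, y) ∈ ℂ²` with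
`y² = 4x³ − g₂(τ)x − g₃(τ)`, there is a unique `z ≠ 0` in the fundamental parallelogram
`L_τ = {s + tτ : s, t ∈ [0,1)}` such that `℘(z;τ) = x` and `℘′(z;τ) = y`; that is,
`z ↦ (℘(z;τ), ℘′(z;τ))` is a bijection from `L_τ∖{0}` onto the affine complex points of
the curve `y² = 4x³ − g₂(τ)x − g₃(τ)`. -/
theorem wp_uniformization (τ : ℂ) (hτ : 0 < τ.im) (x y : ℂ)
    (hxy : y ^ 2 = 4 * x ^ 3 - g2 τ * x - g3 τ) :
    ∃! z : ℂ, (∃ s t : ℝ, s ∈ Set.Ico (0 : ℝ) 1 ∧ t ∈ Set.Ico (0 : ℝ) 1 ∧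
        z = (s : ℂ) + (t : ℂ) * τ) ∧
      z ≠ 0 ∧ wp τ z = x ∧ wp' τ z = y := by
  classical
  set L := WPU.pp τ hτ with hL
  have hwp : wp τ = L.weierstrassP := WPU.wp_eq τ hτ
  have hwp' : wp' τ = L.derivWeierstrassP := by
    ext z; rw [wp', hwp, L.deriv_weierstrassP]
  rw [hwp, hwp']
  rw [WPU.g2_eq τ hτ, WPU.g3_eq τ hτ] at hxy
  have hnot : ∀ s t : ℝ, s ∈ Set.Ico (0 : ℝ) 1 → t ∈ Set.Ico (0 : ℝ) 1 →
      (s : ℂ) + (t : ℂ) * τ ≠ 0 → (s : ℂ) + (t : ℂ) * τ ∉ L.lattice := by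
    intro s t hs ht h0 hmem
    obtain ⟨h1, h2⟩ := WPU.fund_unique τ hτ 0 0 s t (by simp) (by simp) hs ht (by simpa using hmem)
    subst h1 h2
    simp at h0
  obtain ⟨w, hw, hwx, hwy⟩ : ∃ w, w ∉ L.lattice ∧ L.weierstrassP w = x ∧
      L.derivWeierstrassP w = y := by
    obtain ⟨w, hw, hwx⟩ := WPU.surj L x
    have h1 := L.derivWeierstrassP_sq w hw
    rw [hwx, ← hxy] at h1
    rcases sq_eq_sq_iff_eq_or_eq_neg.mp h1 with h | h
    · exact ⟨w, hw, hwx, h⟩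
    · exact ⟨-w, by simpa using hw, by simpa using hwx, by simp [h]⟩
  obtain ⟨s, t, hs, ht, l, hl, hst⟩ := WPU.fund_exists τ hτ w
  refine ⟨(s : ℂ) + t * τ, ⟨⟨s, t, hs, ht, rfl⟩, ?_, ?_, ?_⟩, ?_⟩
  · intro h0
    rw [hst] at h0
    apply hw
    rw [eq_neg_of_add_eq_zero_left h0]
    exact L.lattice.neg_mem hl
  · rw [hst]
    exact (L.weierstrassP_add_coe w ⟨l, hl⟩).trans hwx
  · rw [hst]
    exact (L.derivWeierstrassP_add_coe w ⟨l, hl⟩).trans hwy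
  · rintro _ ⟨⟨s', t', hs', ht', rfl⟩, hz0, hzx, hzy⟩
    have hz := hnot s' t' hs' ht' hz0
    have h1 := WPU.inj L w _ hw hz (hwx.trans hzx.symm) (hwy.trans hzy.symm)
    have h2 := L.lattice.sub_mem h1 hl
    obtain ⟨e1, e2⟩ := WPU.fund_unique τ hτ s t s' t' hs ht hs' ht' (by
      rw [hst]
      convert h2 using 1
      ring)
    rw [e1, e2]
end
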